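/- arXiv:1006.5779 — 2 statements merged into one kernel-verified Lean document; each statement's English description precedes it below -/
import Mathlib

section
/- (de Bruijn identity, even case) Let N be even and let z_1, ..., z_N be integrable functions on a measurable set \Lambda \subset \R. Then \int_{\{x \in \Lambda^N : x_1 < x_2 < \cdots < x_N\}} det_{1 \le i,j \le N}[z_i(x_j)] dx = Pf_{1 \le i,j \le N}[I_{ij}], where I_{ij} = \int_{\{(x_1,x_2) \in \Lambda^2 : x_1 < x_2\}} (z_i(x_1) z_j(x_2) - z_j(x_1) z_i(x_2)) dx_1 dx_2, and Pf denotes the Pfaffian of the antisymmetric matrix (I_{ij}). -/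
open MeasureTheory

/-- The Pfaffian of a `2m × 2m` antisymmetric real matrix, defined via the sum over
permutations `σ` satisfying `σ(2k-1) < σ(2k)` for all `k` (indices written 0-based). -/
noncomputable def pfaffian (m : ℕ) (A : Matrix (Fin (2 * m)) (Fin (2 * m)) ℝ) : ℝ :=
  (1 / (m.factorial : ℝ)) *
    ∑ σ ∈ Finset.univ.filter (fun σ : Equiv.Perm (Fin (2 * m)) =>
        ∀ k : Fin m, σ ⟨2 * k, by have := k.isLt; omega⟩ < σ ⟨2 * k + 1, by have := k.isLt; omega⟩),
      (Equiv.Perm.sign σ : ℝ) *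
        ∏ k : Fin m, A (σ ⟨2 * k, by have := k.isLt; omega⟩) (σ ⟨2 * k + 1, by have := k.isLt; omega⟩)

namespace DeBruijn

open Equiv Finset

/-- The identification `(k, i) ↦ 2k + i` of `Fin m × Fin 2` with `Fin (2m)`. -/
def pairEquiv (m : ℕ) : Fin m × Fin 2 ≃ Fin (2 * m) :=
  finProdFinEquiv.trans (finCongr (mul_comm m 2))

lemma pairEquiv_val {m : ℕ} (k : Fin m) (i : Fin 2) :
    (pairEquiv m (k, i) : ℕ) = 2 * k + i := by
  simp [pairEquiv, add_comm]

lemma pairEquiv_zero {m : ℕ} (k : Fin m) (h : 2 * (k : ℕ) < 2 * m) :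
    (⟨2 * k, h⟩ : Fin (2 * m)) = pairEquiv m (k, 0) := by
  ext; simp [pairEquiv_val]

lemma pairEquiv_one {m : ℕ} (k : Fin m) (h : 2 * (k : ℕ) + 1 < 2 * m) :
    (⟨2 * k + 1, h⟩ : Fin (2 * m)) = pairEquiv m (k, 1) := by
  ext; simp [pairEquiv_val]

/-- `x` increases along each pair of indices `(2k, 2k + 1)`. -/
def PairIncreasing {m : ℕ} {α : Type*} [LT α] (x : Fin (2 * m) → α) : Prop :=
  ∀ k, x (pairEquiv m (k, 0)) < x (pairEquiv m (k, 1))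

open Classical in
lemma pfaffian_eq (m : ℕ) (A : Matrix (Fin (2 * m)) (Fin (2 * m)) ℝ) :
    pfaffian m A = (1 / (m.factorial : ℝ)) *
      ∑ σ : Perm (Fin (2 * m)) with PairIncreasing (σ : Perm (Fin (2 * m))), (Perm.sign σ : ℝ) *
        ∏ k, A (σ (pairEquiv m (k, 0))) (σ (pairEquiv m (k, 1))) := by
  unfold pfaffian
  simp only [pairEquiv_zero, pairEquiv_one]
  congr 1
  refine Finset.sum_congr (Finset.filter_congr fun σ _ => Iff.rfl) fun _ _ => rfl

lemma sum_perm_fin_two {M : Type*} [AddCommMonoid M] (f : Perm (Fin 2) → M) :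
    ∑ p, f p = f 1 + f (swap 0 1) := by
  have : (univ : Finset (Perm (Fin 2))) = {1, swap 0 1} := by decide
  rw [this, sum_pair (by decide)]

/-- The permutation acting by `ε k` on the pair `(2k, 2k + 1)`. -/
def withinPairs {m : ℕ} (ε : Fin m → Perm (Fin 2)) : Perm (Fin (2 * m)) :=
  (pairEquiv m).permCongr (prodCongrRight ε)

lemma withinPairs_apply {m : ℕ} (ε : Fin m → Perm (Fin 2)) (k : Fin m) (i : Fin 2) :
    withinPairs ε (pairEquiv m (k, i)) = pairEquiv m (k, ε k i) := by
  simp [withinPairs]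

lemma withinPairs_inv_apply {m : ℕ} (ε : Fin m → Perm (Fin 2)) (k : Fin m) (i : Fin 2) :
    (withinPairs ε)⁻¹ (pairEquiv m (k, i)) = pairEquiv m (k, (ε k)⁻¹ i) := by
  rw [Perm.inv_eq_iff_eq, withinPairs_apply]; simp

lemma sign_withinPairs {m : ℕ} (ε : Fin m → Perm (Fin 2)) :
    Perm.sign (withinPairs ε) = ∏ k, Perm.sign (ε k) := by
  rw [withinPairs, Perm.sign_permCongr, Perm.sign_prodCongrRight]

open Classical in
lemma sum_pairIncreasing_withinPairs {m : ℕ} (τ : Perm (Fin (2 * m))) :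
    ∑ ε : Fin m → Perm (Fin 2),
      (if PairIncreasing (τ * (withinPairs ε)⁻¹ : Perm _) then (1 : ℝ) else 0) = 1 := by
  have key : ∀ k, ∑ p : Perm (Fin 2),
      (if τ (pairEquiv m (k, p⁻¹ 0)) < τ (pairEquiv m (k, p⁻¹ 1)) then (1 : ℝ) else 0) = 1 := by
    intro k
    have hne : τ (pairEquiv m (k, 0)) ≠ τ (pairEquiv m (k, 1)) := by simp
    rw [sum_perm_fin_two]
    rcases lt_or_gt_of_ne hne with h | h <;> simp [h, h.not_gt]
  refine Eq.trans ?_ (Finset.prod_eq_one (fun k (_ : k ∈ univ) => key k))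
  rw [Finset.prod_univ_sum, Fintype.piFinset_univ]
  refine sum_congr rfl fun ε _ => ?_
  rw [Finset.prod_boole]
  simp only [PairIncreasing, Perm.mul_apply, withinPairs_inv_apply, mem_univ, true_imp_iff]

open Classical in
lemma sum_pairIncreasing_sub_transpose {m : ℕ} (B : Fin (2 * m) → Fin (2 * m) → ℝ) :
    ∑ σ : Perm (Fin (2 * m)) with PairIncreasing (σ : Perm (Fin (2 * m))), (Perm.sign σ : ℝ) *
        ∏ k, (B (σ (pairEquiv m (k, 0))) (σ (pairEquiv m (k, 1))) -
          B (σ (pairEquiv m (k, 1))) (σ (pairEquiv m (k, 0)))) =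
      ∑ σ : Perm (Fin (2 * m)), (Perm.sign σ : ℝ) *
        ∏ k, B (σ (pairEquiv m (k, 0))) (σ (pairEquiv m (k, 1))) := by
  set g : Perm (Fin (2 * m)) → ℝ := fun σ => (Perm.sign σ : ℝ) *
        ∏ k, B (σ (pairEquiv m (k, 0))) (σ (pairEquiv m (k, 1))) with hg
  have expand : ∀ σ : Perm (Fin (2 * m)), (Perm.sign σ : ℝ) *
        ∏ k, (B (σ (pairEquiv m (k, 0))) (σ (pairEquiv m (k, 1))) -
          B (σ (pairEquiv m (k, 1))) (σ (pairEquiv m (k, 0)))) =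
      ∑ ε : Fin m → Perm (Fin 2), g (σ * withinPairs ε) := by
    intro σ
    have h1 : ∀ k, B (σ (pairEquiv m (k, 0))) (σ (pairEquiv m (k, 1))) -
          B (σ (pairEquiv m (k, 1))) (σ (pairEquiv m (k, 0))) =
        ∑ p : Perm (Fin 2), (Perm.sign p : ℝ) *
          B (σ (pairEquiv m (k, p 0))) (σ (pairEquiv m (k, p 1))) := by
      intro k
      rw [sum_perm_fin_two]
      simp [sub_eq_add_neg]
    simp only [h1]
    rw [Finset.prod_univ_sum, Fintype.piFinset_univ, Finset.mul_sum]
    refine sum_congr rfl fun ε _ => ?_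
    simp [hg, withinPairs_apply, sign_withinPairs, Finset.prod_mul_distrib, mul_assoc]
  simp only [expand]
  rw [Finset.sum_filter]
  calc _ = ∑ σ : Perm (Fin (2 * m)), ∑ ε : Fin m → Perm (Fin 2),
        (if PairIncreasing σ then (1 : ℝ) else 0) * g (σ * withinPairs ε) := by
        refine sum_congr rfl fun σ _ => ?_
        split_ifs <;> simp
    _ = ∑ ε : Fin m → Perm (Fin 2), ∑ σ : Perm (Fin (2 * m)),
        (if PairIncreasing (σ * (withinPairs ε)⁻¹ : Perm _) then (1 : ℝ) else 0) * g σ := by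
        rw [sum_comm]
        refine sum_congr rfl fun ε _ => ?_
        refine Fintype.sum_equiv (Equiv.mulRight (withinPairs ε)) _ _ fun σ => ?_
        simp
    _ = _ := by
        rw [sum_comm]
        refine sum_congr rfl fun σ _ => ?_
        rw [← Finset.sum_mul, sum_pairIncreasing_withinPairs, one_mul]

/-- The permutation moving the pairs `(2k, 2k + 1)` by `π`. -/
def permPairs {m : ℕ} (π : Perm (Fin m)) : Perm (Fin (2 * m)) :=
  (pairEquiv m).permCongr (prodCongrLeft fun _ => π)

lemma permPairs_apply {m : ℕ} (π : Perm (Fin m)) (k : Fin m) (i : Fin 2) :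
    permPairs π (pairEquiv m (k, i)) = pairEquiv m (π k, i) := by
  simp [permPairs]

lemma sign_permPairs {m : ℕ} (π : Perm (Fin m)) : Perm.sign (permPairs π) = 1 := by
  rw [permPairs, Perm.sign_permCongr, Perm.sign_prodCongrLeft]
  simp

/-- `σ` maps some pair `(2k, 2k + 1)` to the pair `(2j, 2j + 1)`. -/
def HitsPair {m : ℕ} (σ : Perm (Fin (2 * m))) (j : Fin m) : Prop :=
  ∃ k, σ (pairEquiv m (k, 0)) = pairEquiv m (j, 0) ∧ σ (pairEquiv m (k, 1)) = pairEquiv m (j, 1)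

/-- Left multiplication by the transposition of `2j` and `2j + 1`. -/
def swapPair {m : ℕ} (j : Fin m) (σ : Perm (Fin (2 * m))) : Perm (Fin (2 * m)) :=
  swap (pairEquiv m (j, 0)) (pairEquiv m (j, 1)) * σ

lemma swapPair_swapPair {m : ℕ} (j : Fin m) (σ : Perm (Fin (2 * m))) :
    swapPair j (swapPair j σ) = σ := by
  simp [swapPair]

lemma PairIncreasing.swapPair {m : ℕ} {j : Fin m} {σ : Perm (Fin (2 * m))}
    (hσ : PairIncreasing σ) (hj : ¬ HitsPair σ j) : PairIncreasing (swapPair j σ) := by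
  intro k
  have hk := hσ k
  have hjk : ¬ (_ ∧ _) := fun h => hj ⟨k, h⟩
  simp only [DeBruijn.swapPair, Perm.mul_apply, swap_apply_def]
  generalize σ (pairEquiv m (k, 0)) = u at *
  generalize σ (pairEquiv m (k, 1)) = v at *
  have h0 := pairEquiv_val j 0
  have h1 := pairEquiv_val j 1
  generalize pairEquiv m (j, 0) = a at *
  generalize pairEquiv m (j, 1) = b at *
  simp only [Fin.val_zero, Fin.val_one] at h0 h1
  split_ifs <;> simp only [Fin.ext_iff, Fin.lt_def] at * <;> omega

lemma hitsPair_swapPair {m : ℕ} {j : Fin m} {σ : Perm (Fin (2 * m))}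
    (hσ : PairIncreasing σ) (hj : ¬ HitsPair σ j) (i : Fin m) :
    HitsPair (swapPair j σ) i ↔ HitsPair σ i := by
  by_cases hij : i = j
  · subst hij
    refine iff_of_false ?_ hj
    rintro ⟨k, h0, h1⟩
    have := hσ k
    simp only [swapPair, Perm.mul_apply, swap_apply_eq_iff, swap_apply_left,
      swap_apply_right] at h0 h1
    rw [h0, h1, Fin.lt_def, pairEquiv_val, pairEquiv_val] at this
    simp at this
  · have h : ∀ l, swap (pairEquiv m (j, 0)) (pairEquiv m (j, 1)) (pairEquiv m (i, l)) =
        pairEquiv m (i, l) := fun l =>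
      swap_apply_of_ne_of_ne (by simp [hij]) (by simp [hij])
    simp [HitsPair, swapPair, swap_apply_eq_iff, h]

open Classical in
lemma sum_sign_not_hitsPair (m : ℕ) :
    ∑ σ : Perm (Fin (2 * m)) with PairIncreasing (σ : Perm (Fin (2 * m))) ∧ ¬ ∀ j, HitsPair σ j,
      (Perm.sign σ : ℝ) = 0 := by
  set missed : Perm (Fin (2 * m)) → Set (Fin m) := fun σ => {j | ¬ HitsPair σ j}
  have hne : ∀ σ ∈ (univ.filter fun σ : Perm (Fin (2 * m)) =>
      PairIncreasing σ ∧ ¬ ∀ j, HitsPair σ j), (missed σ).Nonempty := by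
    intro σ hσ
    simpa [missed, Set.Nonempty] using (mem_filter.1 hσ).2.2
  have hinc : ∀ σ ∈ (univ.filter fun σ : Perm (Fin (2 * m)) =>
      PairIncreasing σ ∧ ¬ ∀ j, HitsPair σ j), PairIncreasing σ :=
    fun σ hσ => (mem_filter.1 hσ).2.1
  have hmissed : ∀ σ (hσ : σ ∈ (univ.filter fun σ : Perm (Fin (2 * m)) =>
      PairIncreasing σ ∧ ¬ ∀ j, HitsPair σ j)),
      missed (swapPair (hne σ hσ).some σ) = missed σ := fun σ hσ =>
    Set.ext fun i => not_congr (hitsPair_swapPair (hinc σ hσ) (hne σ hσ).some_mem i)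
  have hsign : ∀ (j : Fin m) (σ : Perm (Fin (2 * m))),
      Perm.sign (swapPair j σ) = - Perm.sign σ := fun j σ => by
    simp [swapPair]
  refine Finset.sum_involution (fun σ hσ => swapPair (hne σ hσ).some σ) ?_ ?_ ?_ ?_
  · intro σ hσ
    simp [hsign]
  · intro σ hσ _ h
    have := hsign (hne σ hσ).some σ
    rw [h] at this
    rcases Int.units_eq_one_or (Perm.sign σ) with h' | h' <;> simp [h'] at this
  · intro σ hσ
    refine mem_filter.2 ⟨mem_univ _, (hinc σ hσ).swapPair (hne σ hσ).some_mem, fun h => ?_⟩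
    have h2 := (hne σ hσ).some_mem
    exact (Set.ext_iff.1 (hmissed σ hσ) _).2 h2 (h _)
  · intro σ hσ
    have hsome : ∀ {s t : Set (Fin m)} (hs : s.Nonempty) (ht : t.Nonempty), s = t →
        hs.some = ht.some := by
      rintro s _ hs ht rfl; rfl
    exact (congrArg (swapPair · _) (hsome _ _ (hmissed σ hσ))).trans (swapPair_swapPair _ _)

open Classical in
/-- The signed count of the permutations increasing along pairs, that is, `m!` times the
Pfaffian of the matrix whose entries above the diagonal are all `1`. -/
lemma sum_sign_pairIncreasing (m : ℕ) :
    ∑ σ : Perm (Fin (2 * m)) with PairIncreasing (σ : Perm (Fin (2 * m))), (Perm.sign σ : ℝ) = m.factorial := by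
  rw [← Finset.sum_filter_add_sum_filter_not _ (fun σ => ∀ j, HitsPair σ j), filter_filter,
    filter_filter, sum_sign_not_hitsPair, add_zero]
  have hcard : (m.factorial : ℝ) = ∑ _π : Perm (Fin m), (1 : ℝ) := by
    simp [Fintype.card_perm]
  rw [hcard]
  symm
  refine Finset.sum_bij (fun π _ => permPairs π) ?_ ?_ ?_ ?_
  · intro π _
    refine mem_filter.2 ⟨mem_univ _, fun k => ?_, fun j => ⟨π.symm j, ?_⟩⟩
    · simp [permPairs_apply, Fin.lt_def, pairEquiv_val]
    · simp [permPairs_apply]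
  · intro π _ π' _ h
    ext k : 1
    simpa [permPairs_apply] using congrArg (fun σ => σ (pairEquiv m (k, 0))) h
  · intro σ hσ
    choose f hf0 hf1 using (mem_filter.1 hσ).2.2
    have hinj : Function.Injective f := fun i j h => by
      have := hf0 i
      rw [h, hf0 j] at this
      simpa using this.symm
    refine ⟨(Equiv.ofBijective f (Finite.injective_iff_bijective.1 hinj)).symm, mem_univ _, ?_⟩
    ext1 x
    obtain ⟨⟨k, i⟩, rfl⟩ := (pairEquiv m).surjective x
    obtain ⟨j, rfl⟩ := (Finite.injective_iff_bijective.1 hinj).2 k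
    rw [permPairs_apply, Equiv.ofBijective_symm_apply_apply]
    fin_cases i
    · exact (hf0 j).symm
    · exact (hf1 j).symm
  · intro π _
    simp [sign_permPairs]

/-- Reading off the coordinates of `m` points of the plane, in order. -/
def unpair {m : ℕ} (y : Fin m → ℝ × ℝ) (i : Fin (2 * m)) : ℝ :=
  ![(y ((pairEquiv m).symm i).1).1, (y ((pairEquiv m).symm i).1).2] ((pairEquiv m).symm i).2

@[simp] lemma unpair_zero {m : ℕ} (y : Fin m → ℝ × ℝ) (k : Fin m) :
    unpair y (pairEquiv m (k, 0)) = (y k).1 := by simp [unpair]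

@[simp] lemma unpair_one {m : ℕ} (y : Fin m → ℝ × ℝ) (k : Fin m) :
    unpair y (pairEquiv m (k, 1)) = (y k).2 := by simp [unpair]

lemma prod_pairs {m : ℕ} {M : Type*} [CommMonoid M] (f : Fin (2 * m) → M) :
    ∏ i, f i = ∏ k, f (pairEquiv m (k, 0)) * f (pairEquiv m (k, 1)) := by
  rw [← (pairEquiv m).prod_comp, Fintype.prod_prod_type]
  simp

lemma forall_pairs {m : ℕ} {P : Fin (2 * m) → Prop} :
    (∀ i, P i) ↔ ∀ k, P (pairEquiv m (k, 0)) ∧ P (pairEquiv m (k, 1)) := by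
  rw [← (pairEquiv m).forall_congr_right, Prod.forall]
  simp [Fin.forall_fin_two]

lemma measurePreserving_unpair (m : ℕ) (μ : Measure ℝ) [SigmaFinite μ] :
    MeasurePreserving (unpair (m := m)) (Measure.pi fun _ => μ.prod μ) (Measure.pi fun _ => μ) := by
  have hmeas : Measurable (unpair (m := m)) := by
    refine measurable_pi_iff.2 fun i => ?_
    obtain ⟨⟨k, i⟩, rfl⟩ := (pairEquiv m).surjective i
    fin_cases i
    · simp only [Fin.zero_eta, unpair_zero]; fun_prop
    · simp only [Fin.mk_one, unpair_one]; fun_prop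
  refine ⟨hmeas, (Measure.pi_eq fun s hs => ?_).symm⟩
  rw [Measure.map_apply hmeas (MeasurableSet.univ_pi hs)]
  have hpre : unpair (m := m) ⁻¹' Set.univ.pi s =
      Set.univ.pi fun k => s (pairEquiv m (k, 0)) ×ˢ s (pairEquiv m (k, 1)) := by
    ext y
    simp only [Set.mem_preimage, Set.mem_univ_pi, Set.mem_prod]
    rw [forall_pairs]
    simp
  rw [hpre, Measure.pi_pi, prod_pairs]
  simp [Measure.prod_prod]

lemma measurableSet_pairIncreasing (m : ℕ) :
    MeasurableSet {x : Fin (2 * m) → ℝ | PairIncreasing x} := by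
  simp only [PairIncreasing, Set.ofPred_forall]
  exact MeasurableSet.iInter fun k =>
    measurableSet_lt (measurable_pi_apply _) (measurable_pi_apply _)

lemma measurableSet_strictMono (n : ℕ) :
    MeasurableSet {x : Fin n → ℝ | StrictMono x} := by
  simp only [StrictMono, Set.ofPred_forall]
  exact MeasurableSet.iInter fun i => MeasurableSet.iInter fun j => MeasurableSet.iInter fun _ =>
    measurableSet_lt (measurable_pi_apply _) (measurable_pi_apply _)

lemma prod_setIntegral_lt {m : ℕ} (μ : Measure ℝ) [SigmaFinite μ] (w : Fin (2 * m) → ℝ → ℝ)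
    (hw : ∀ i, Integrable (w i) μ) :
    ∏ k, ∫ p in {p : ℝ × ℝ | p.1 < p.2},
        w (pairEquiv m (k, 0)) p.1 * w (pairEquiv m (k, 1)) p.2 ∂(μ.prod μ) =
      ∫ x in {x : Fin (2 * m) → ℝ | PairIncreasing x}, ∏ i, w i (x i)
        ∂(Measure.pi fun _ => μ) := by
  have hlt : MeasurableSet {p : ℝ × ℝ | p.1 < p.2} :=
    measurableSet_lt measurable_fst measurable_snd
  have hint : Integrable (fun x : Fin (2 * m) → ℝ => ∏ i, w i (x i)) (Measure.pi fun _ => μ) :=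
    Integrable.fintype_prod hw
  simp only [← integral_indicator hlt, ← integral_indicator (measurableSet_pairIncreasing m)]
  rw [← integral_fintype_prod_eq_prod, ← (measurePreserving_unpair m μ).map_eq, integral_map
    (measurePreserving_unpair m μ).measurable.aemeasurable]
  · refine integral_congr_ae (.of_forall fun y => ?_)
    classical
    simp only [Set.indicator_apply, Set.mem_ofPred_eq, PairIncreasing, unpair_zero, unpair_one]
    rw [Finset.prod_ite_zero, prod_pairs]
    simp
  · rw [(measurePreserving_unpair m μ).map_eq]
    exact (hint.indicator (measurableSet_pairIncreasing m)).aestronglyMeasurable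

lemma integrable_det {n : ℕ} (μ : Measure ℝ) [SigmaFinite μ] (z : Fin n → ℝ → ℝ)
    (hz : ∀ i, Integrable (z i) μ) :
    Integrable (fun x : Fin n → ℝ => Matrix.det (Matrix.of fun i j => z i (x j)))
      (Measure.pi fun _ => μ) := by
  simp only [Matrix.det_apply', Matrix.of_apply]
  exact integrable_finsetSum _ fun σ _ =>
    (Integrable.fintype_prod fun i => hz (σ i)).const_mul _

lemma sum_sign_prod_setIntegral_lt {m : ℕ} (μ : Measure ℝ) [SigmaFinite μ]
    (z : Fin (2 * m) → ℝ → ℝ) (hz : ∀ i, Integrable (z i) μ) :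
    ∑ σ : Perm (Fin (2 * m)), (Perm.sign σ : ℝ) *
        ∏ k, ∫ p in {p : ℝ × ℝ | p.1 < p.2},
          z (σ (pairEquiv m (k, 0))) p.1 * z (σ (pairEquiv m (k, 1))) p.2 ∂(μ.prod μ) =
      ∫ x in {x : Fin (2 * m) → ℝ | PairIncreasing x},
        Matrix.det (Matrix.of fun i j => z i (x j)) ∂(Measure.pi fun _ => μ) := by
  simp only [Matrix.det_apply', Matrix.of_apply]
  have hint : ∀ σ : Perm (Fin (2 * m)), Integrable (fun x : Fin (2 * m) → ℝ =>
      (Perm.sign σ : ℝ) * ∏ i, z (σ i) (x i)) (Measure.pi fun _ => μ) := fun σ =>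
    (Integrable.fintype_prod fun i => hz (σ i)).const_mul _
  rw [integral_finsetSum _ fun σ _ => (hint σ).integrableOn]
  refine sum_congr rfl fun σ _ => ?_
  rw [integral_const_mul]
  congr 1
  exact prod_setIntegral_lt μ (fun i => z (σ i)) fun i => hz (σ i)

lemma ae_injective_pi {n : ℕ} :
    ∀ᵐ x : Fin n → ℝ, Function.Injective x := by
  have h : ∀ i j : Fin n, i ≠ j → ∀ᵐ x : Fin n → ℝ, x i ≠ x j := by
    intro i j hij
    let L : (Fin n → ℝ) →ₗ[ℝ] ℝ := LinearMap.proj (R := ℝ) (φ := fun _ : Fin n => ℝ) i -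
      LinearMap.proj (R := ℝ) (φ := fun _ : Fin n => ℝ) j
    have hL : L.ker ≠ ⊤ := by
      intro h
      have h1 : L (Pi.single i 1) = 0 := by
        rw [← LinearMap.mem_ker, h]; trivial
      simp [L, hij.symm] at h1
    have := Measure.addHaar_submodule (volume : Measure (Fin n → ℝ)) L.ker hL
    refine (measure_eq_zero_iff_ae_notMem.1 this).mono fun x hx hxij => hx ?_
    simp [L, hxij]
  have h' : ∀ᵐ x : Fin n → ℝ, ∀ i j : Fin n, i ≠ j → x i ≠ x j := by
    simpa only [ae_all_iff, Filter.eventually_imp_distrib_left] using h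
  filter_upwards [h'] with x hx i j hij
  by_contra hne
  exact hx i j hne hij

open Classical in
lemma sum_strictMono_comp {n : ℕ} {x : Fin n → ℝ} (hx : Function.Injective x) :
    ∑ π : Perm (Fin n), (if StrictMono (x ∘ π) then (1 : ℝ) else 0) = 1 := by
  rw [Finset.sum_eq_single (Tuple.sort x)]
  · rw [if_pos ((Tuple.monotone_sort x).strictMono_of_injective
      (hx.comp (Tuple.sort x).injective))]
  · intro π _ hπ
    refine if_neg fun h => hπ ?_
    ext1 i
    exact hx (congrFun (Tuple.unique_monotone h.monotone (Tuple.monotone_sort x)) i)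
  · simp

lemma measurePreserving_comp_perm {n : ℕ} (μ : Measure ℝ) [SigmaFinite μ] (π : Perm (Fin n)) :
    MeasurePreserving (fun x : Fin n → ℝ => x ∘ π)
      (Measure.pi fun _ => μ) (Measure.pi fun _ => μ) := by
  have hmeas : Measurable (fun x : Fin n → ℝ => x ∘ π) :=
    measurable_pi_iff.2 fun i => measurable_pi_apply _
  refine ⟨hmeas, (Measure.pi_eq fun s hs => ?_).symm⟩
  rw [Measure.map_apply hmeas (MeasurableSet.univ_pi hs)]
  have hpre : (fun x : Fin n → ℝ => x ∘ π) ⁻¹' Set.univ.pi s =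
      Set.univ.pi fun i => s (π.symm i) := by
    ext y
    simp only [Set.mem_preimage, Set.mem_univ_pi, Function.comp_apply]
    refine Iff.trans ?_ (π.forall_congr_right (q := fun i => y i ∈ s (π.symm i)))
    simp
  rw [hpre, Measure.pi_pi]
  exact π.symm.prod_comp fun i => μ (s i)

open Classical in
/-- The integral over a set of an alternating function, reduced to increasing tuples. -/
lemma setIntegral_alternating {n : ℕ} (μ : Measure ℝ) [SigmaFinite μ]
    (hμ : Measure.pi (fun _ : Fin n => μ) ≪ volume) {F : (Fin n → ℝ) → ℝ}
    (hF : Integrable F (Measure.pi fun _ => μ))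
    (hsign : ∀ x (π : Perm (Fin n)), F (x ∘ π) = (Perm.sign π : ℝ) * F x)
    {D : Set (Fin n → ℝ)} (hD : MeasurableSet D) (c : Perm (Fin n) → ℝ)
    (hc : ∀ (π : Perm (Fin n)) x, StrictMono x → c π = if x ∘ π ∈ D then 1 else 0) :
    ∫ x in D, F x ∂(Measure.pi fun _ => μ) =
      (∑ π, (Perm.sign π : ℝ) * c π) *
        ∫ x in {x : Fin n → ℝ | StrictMono x}, F x ∂(Measure.pi fun _ => μ) := by
  set C := {x : Fin n → ℝ | StrictMono x}
  have hC : MeasurableSet C := measurableSet_strictMono n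
  have hpre : ∀ π : Perm (Fin n), MeasurableSet ((fun x : Fin n → ℝ => x ∘ π) ⁻¹' C) := fun π =>
    (measurePreserving_comp_perm μ π).measurable hC
  have hsplit : ∫ x in D, F x ∂(Measure.pi fun _ => μ) =
      ∫ x, ∑ π : Perm (Fin n), ((fun x : Fin n → ℝ => x ∘ π) ⁻¹' C).indicator (D.indicator F) x
        ∂(Measure.pi fun _ => μ) := by
    rw [← integral_indicator hD]
    refine integral_congr_ae ?_
    filter_upwards [hμ.ae_le ae_injective_pi] with x hx
    have h := sum_strictMono_comp hx
    rw [← one_mul (D.indicator F x), ← h, Finset.sum_mul]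
    refine sum_congr rfl fun π _ => ?_
    by_cases h : StrictMono (x ∘ π) <;> simp [Set.indicator_apply, C, h]
  have hterm : ∀ π : Perm (Fin n),
      ∫ x, ((fun x : Fin n → ℝ => x ∘ π) ⁻¹' C).indicator (D.indicator F) x
        ∂(Measure.pi fun _ => μ) =
      (Perm.sign π⁻¹ : ℝ) * c π⁻¹ * ∫ x in C, F x ∂(Measure.pi fun _ => μ) := by
    intro π
    have hmp := measurePreserving_comp_perm μ π⁻¹
    rw [← hmp.map_eq, integral_map hmp.measurable.aemeasurable, hmp.map_eq,
      ← integral_indicator hC, ← integral_const_mul]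
    · refine integral_congr_ae (.of_forall fun x => ?_)
      have hx : (x ∘ ⇑π⁻¹) ∘ ⇑π = x := by ext; simp
      simp only [Set.indicator_apply, Set.mem_preimage, hx, hsign]
      by_cases h : x ∈ C
      · rw [hc π⁻¹ x h]
        simp [h]
      · simp [h]
    · rw [hmp.map_eq]
      exact ((hF.indicator hD).indicator (hpre π)).aestronglyMeasurable
  rw [hsplit, integral_finsetSum _ fun π _ => (hF.indicator hD).indicator (hpre π)]
  simp only [hterm]
  rw [← Finset.sum_mul]
  congr 1
  exact Equiv.sum_comp (Equiv.inv (Perm (Fin n))) fun π => (Perm.sign π : ℝ) * c π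

end DeBruijn

open DeBruijn in
/-- The de Bruijn identity in the even case `N = 2m`. -/
theorem deBruijn_even (m : ℕ) (Λ : Set ℝ) (hΛ : MeasurableSet Λ)
    (z : Fin (2 * m) → ℝ → ℝ) (hz : ∀ i, IntegrableOn (z i) Λ) :
    (∫ x in {x : Fin (2 * m) → ℝ | (∀ i, x i ∈ Λ) ∧ StrictMono x},
        Matrix.det (Matrix.of fun i j : Fin (2 * m) => z i (x j))) =
      pfaffian m (Matrix.of fun i j : Fin (2 * m) =>
        ∫ p in {p : ℝ × ℝ | p.1 ∈ Λ ∧ p.2 ∈ Λ ∧ p.1 < p.2},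
          (z i p.1 * z j p.2 - z j p.1 * z i p.2)) := by
  classical
  set μ : Measure ℝ := volume.restrict Λ
  set B : Fin (2 * m) → Fin (2 * m) → ℝ := fun i j =>
    ∫ p in {p : ℝ × ℝ | p.1 < p.2}, z i p.1 * z j p.2 ∂(μ.prod μ)
  have hlt : MeasurableSet {p : ℝ × ℝ | p.1 < p.2} :=
    measurableSet_lt measurable_fst measurable_snd
  have hpi : Measure.pi (fun _ : Fin (2 * m) => μ) =
      volume.restrict (Set.univ.pi fun _ => Λ) :=
    (Measure.restrict_pi_pi (fun _ => volume) _).symm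
  have hA : ∀ i j, ∫ p in {p : ℝ × ℝ | p.1 ∈ Λ ∧ p.2 ∈ Λ ∧ p.1 < p.2},
      (z i p.1 * z j p.2 - z j p.1 * z i p.2) = B i j - B j i := by
    intro i j
    have hset : {p : ℝ × ℝ | p.1 ∈ Λ ∧ p.2 ∈ Λ ∧ p.1 < p.2} =
        {p : ℝ × ℝ | p.1 < p.2} ∩ Λ ×ˢ Λ := by
      ext p
      simp only [Set.mem_ofPred_eq, Set.mem_inter_iff, Set.mem_prod]
      tauto
    rw [hset, ← Measure.restrict_restrict hlt, Measure.volume_eq_prod, ← Measure.prod_restrict]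
    exact integral_sub ((hz i).mul_prod (hz j)).integrableOn ((hz j).mul_prod (hz i)).integrableOn
  have hL : {x : Fin (2 * m) → ℝ | (∀ i, x i ∈ Λ) ∧ StrictMono x} =
      {x | StrictMono x} ∩ Set.univ.pi fun _ => Λ := by
    ext x
    simp only [Set.mem_ofPred_eq, Set.mem_inter_iff, Set.mem_univ_pi]
    tauto
  rw [hL, ← Measure.restrict_restrict (measurableSet_strictMono _), ← hpi, pfaffian_eq]
  simp only [Matrix.of_apply, hA]
  rw [sum_pairIncreasing_sub_transpose, sum_sign_prod_setIntegral_lt μ z hz,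
    setIntegral_alternating μ (hpi ▸ Measure.absolutelyContinuous_of_le Measure.restrict_le_self)
      (integrable_det μ z hz) ?_ (measurableSet_pairIncreasing m)
      (fun π => if PairIncreasing π then 1 else 0) ?_]
  · simp only [mul_ite, mul_one, mul_zero]
    rw [← Finset.sum_filter, sum_sign_pairIncreasing, ← mul_assoc, one_div,
      inv_mul_cancel₀ (by positivity), one_mul]
  · intro x π
    exact Matrix.det_permute' π (Matrix.of fun i j => z i (x j))
  · intro π x hx
    exact if_congr (forall_congr' fun k => hx.lt_iff_lt.symm) rfl rfl
end

section
/- Leading-order asymptotics of the Karlin–McGregor determinant at coinciding start points: for fixed T > 0 and b \in \R^N with b_1 < \cdots < b_N, as a = (a_1,...,a_N) with a_1 < \cdots < a_N tends to 0, det_{1\le i,j\le N}[p(T, b_i|a_j)] = (T^{-N^2/2}/((2\pi)^{N/2} \prod_{k=1}^N (k-1)!)) e^{-|b|^2/(2T)} \prod_{1\le i<j\le N}[(a_j-a_i)(b_j-b_i)] (1 + O(|a|)), where p(t,y|x) = e^{-(x-y)^2/(2t)}/\sqrt{2\pi t}. -/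
open Asymptotics Filter

/-- The free Gaussian heat kernel on `ℝ`. -/
noncomputable def heatKernel (t y x : ℝ) : ℝ :=
  Real.exp (-(x - y) ^ 2 / (2 * t)) / Real.sqrt (2 * Real.pi * t)

/-- **Generalized Rolle theorem**: a function vanishing at `n + 1` points of an interval has an
`n`-th derivative vanishing somewhere in that interval. -/
theorem exists_iteratedDeriv_eq_zero {l u : ℝ} (n : ℕ) {F : ℝ → ℝ} (hF : ContDiff ℝ n F)
    (x : Fin (n + 1) → ℝ) (hx : StrictMono x) (hmem : ∀ i, x i ∈ Set.Icc l u)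
    (hzero : ∀ i, F (x i) = 0) : ∃ ξ ∈ Set.Icc l u, iteratedDeriv n F ξ = 0 := by
  induction n generalizing F with
  | zero => exact ⟨x 0, hmem 0, by simpa using hzero 0⟩
  | succ n ih =>
    have rolle (i : Fin (n + 1)) : ∃ y ∈ Set.Ioo (x i.castSucc) (x i.succ), deriv F y = 0 :=
      exists_deriv_eq_zero (hx Fin.castSucc_lt_succ) hF.continuous.continuousOn
        (by rw [hzero, hzero])
    choose y hy hy0 using rolle
    have hF' : ContDiff ℝ n (deriv F) := ContDiff.deriv' (by exact_mod_cast hF)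
    rw [iteratedDeriv_succ']
    refine ih hF' y (Fin.strictMono_iff_lt_succ.2 fun i => ?_) (fun i => ?_) hy0
    · refine (hy i.castSucc).2.trans ?_
      rw [Fin.succ_castSucc]
      exact (hy i.succ).1
    · exact ⟨(hmem _).1.trans (hy i).1.le, (hy i).2.le.trans (hmem _).2⟩

theorem Polynomial.iteratedDeriv_eval (P : Polynomial ℝ) (n : ℕ) :
    iteratedDeriv n (fun x => P.eval x) = fun x => (derivative^[n] P).eval x := by
  induction n with
  | zero => simp
  | succ n ih =>
    rw [iteratedDeriv_succ, ih, Function.iterate_succ_apply']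
    ext x
    exact Polynomial.deriv _

/-- Error formula for Lagrange interpolation of a function vanishing at all the nodes. -/
theorem exists_factorial_mul_eq_prod_sub_mul_iteratedDeriv {l u : ℝ} (s : Finset ℝ) {F : ℝ → ℝ}
    (hF : ContDiff ℝ s.card F) (hs : ∀ y ∈ s, y ∈ Set.Icc l u) (hzero : ∀ y ∈ s, F y = 0)
    {t : ℝ} (ht : t ∈ Set.Icc l u) (hts : t ∉ s) :
    ∃ ξ ∈ Set.Icc l u,
      (s.card.factorial : ℝ) * F t = (∏ y ∈ s, (t - y)) * iteratedDeriv s.card F ξ := by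
  set P : Polynomial ℝ := ∏ y ∈ s, (Polynomial.X - Polynomial.C y) with hP
  have hPeval (z : ℝ) : P.eval z = ∏ y ∈ s, (z - y) := by simp [hP, Polynomial.eval_prod]
  have hne : P.eval t ≠ 0 := by
    rw [hPeval]
    exact Finset.prod_ne_zero_iff.2 fun y hy => sub_ne_zero.2 fun h => hts (h ▸ hy)
  have hPsmooth : ContDiff ℝ s.card fun z => F t / P.eval t * P.eval z :=
    contDiff_const.mul (by simpa using P.contDiff_aeval (𝕜 := ℝ) s.card)
  have hcard : (insert t s).card = s.card + 1 := Finset.card_insert_of_notMem hts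
  have hnode (i) : (insert t s).orderEmbOfFin hcard i ∈ insert t s :=
    Finset.orderEmbOfFin_mem _ _ _
  have hnode_mem (i) : (insert t s).orderEmbOfFin hcard i ∈ Set.Icc l u := by
    rcases Finset.mem_insert.1 (hnode i) with h | h
    · rwa [h]
    · exact hs _ h
  have hnode_zero (i) : F ((insert t s).orderEmbOfFin hcard i) -
      F t / P.eval t * P.eval ((insert t s).orderEmbOfFin hcard i) = 0 := by
    rcases Finset.mem_insert.1 (hnode i) with h | h
    · simp [h, hne]
    · have : P.eval ((insert t s).orderEmbOfFin hcard i) = 0 := by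
        rw [hPeval]
        exact Finset.prod_eq_zero h (sub_self _)
      simp [hzero _ h, this]
  obtain ⟨ξ, hξ, h⟩ := exists_iteratedDeriv_eq_zero s.card (hF.sub hPsmooth) _
    ((insert t s).orderEmbOfFin hcard).strictMono hnode_mem hnode_zero
  refine ⟨ξ, hξ, ?_⟩
  have hfact : (Polynomial.derivative^[s.card] P).eval ξ = s.card.factorial := by
    simp [hP, Polynomial.iterate_derivative_prod_X_sub_C le_rfl]
  have hsub := iteratedDeriv_sub hF.contDiffAt (hPsmooth.contDiffAt (x := ξ))
  rw [iteratedDeriv_const_mul_field, Polynomial.iteratedDeriv_eval] at hsub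
  beta_reduce at hsub
  rw [hfact] at hsub
  have hderiv : iteratedDeriv s.card F ξ = F t / P.eval t * s.card.factorial :=
    sub_eq_zero.1 (hsub.symm.trans h)
  rw [hderiv, ← hPeval]
  field_simp

theorem Matrix.det_updateCol_eq_sum_adjugate {n R : Type*} [Fintype n] [DecidableEq n]
    [CommRing R] (A : Matrix n n R) (j : n) (v : n → R) :
    (A.updateCol j v).det = ∑ i, A.adjugate j i * v i := by
  rw [← Matrix.cramer_apply, Matrix.cramer_eq_adjugate_mulVec]
  rfl

/-- Mean value theorem for determinants of alternant type, with the columns indexed by `S`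
replaced by derivatives. -/
theorem exists_prod_factorial_mul_det_eq_of_finset {N : ℕ} {l u : ℝ} {f : Fin N → ℝ → ℝ}
    (hf : ∀ i, ContDiff ℝ N (f i)) {a : Fin N → ℝ} (ha : StrictMono a)
    (hmem : ∀ i, a i ∈ Set.Icc l u) (S : Finset (Fin N)) :
    ∃ ξ : Fin N → ℝ, (∀ j, ξ j ∈ Set.Icc l u) ∧
      (∏ j ∈ S, ((j : ℕ).factorial : ℝ)) * (Matrix.of fun i j => f i (a j)).det =
        (∏ j ∈ S, ∏ i ∈ Finset.Iio j, (a j - a i)) *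
          (Matrix.of fun i j =>
            if j ∈ S then iteratedDeriv j (f i) (ξ j) else f i (a j)).det := by
  induction S using Finset.induction_on_min with
  | empty => exact ⟨a, hmem, by simp⟩
  | insert k S hk ih =>
    obtain ⟨ξ, hξ, h⟩ := ih
    have hkS : k ∉ S := fun hkS => (hk k hkS).false
    set M : Matrix (Fin N) (Fin N) ℝ :=
      Matrix.of fun i j => if j ∈ S then iteratedDeriv j (f i) (ξ j) else f i (a j) with hM
    set F : ℝ → ℝ := fun t => ∑ i, M.adjugate k i * f i t with hF
    have hFdet (t : ℝ) : F t = (M.updateCol k fun i => f i t).det :=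
      (M.det_updateCol_eq_sum_adjugate k _).symm
    have hfk (i : Fin N) : ContDiff ℝ (k : ℕ) (f i) :=
      (hf i).of_le (by exact_mod_cast k.2.le)
    have hFsmooth : ContDiff ℝ (k : ℕ) F := ContDiff.sum fun i _ => contDiff_const.mul (hfk i)
    have hFderiv (t : ℝ) : iteratedDeriv k F t =
        (M.updateCol k fun i => iteratedDeriv k (f i) t).det := by
      rw [M.det_updateCol_eq_sum_adjugate, hF,
        iteratedDeriv_fun_sum fun i _ => (contDiff_const.mul (hfk i)).contDiffAt]
      simp only [iteratedDeriv_const_mul_field]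
    have hcard : ((Finset.Iio k).map ⟨a, ha.injective⟩).card = k := by simp
    obtain ⟨η, hη, hval⟩ := exists_factorial_mul_eq_prod_sub_mul_iteratedDeriv (l := l) (u := u)
      (F := F) ((Finset.Iio k).map ⟨a, ha.injective⟩) (by rwa [hcard]) (by simpa using fun i _ => hmem i)
      (by
        simp only [Finset.mem_map, Finset.mem_Iio, Function.Embedding.coeFn_mk,
          forall_exists_index, and_imp, forall_apply_eq_imp_iff₂]
        intro i hi
        have hiS : i ∉ S := fun hiS => (hi.trans (hk i hiS)).false
        rw [hFdet]
        refine Matrix.det_zero_of_column_eq hi.ne fun r => ?_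
        simp [hi.ne, hM, hiS])
      (hmem k) (by simp)
    rw [hcard, Finset.prod_map, hFderiv, hFdet] at hval
    have hcol : (M.updateCol k fun i => f i (a k)) = M := by
      ext i j
      by_cases hj : j = k
      · subst hj; simp [hM, hkS]
      · simp [hj]
    rw [hcol] at hval
    have hnew : (M.updateCol k fun i => iteratedDeriv k (f i) η) =
        Matrix.of fun i j => if j ∈ insert k S then
          iteratedDeriv j (f i) (Function.update ξ k η j) else f i (a j) := by
      ext i j
      by_cases hj : j = k
      · subst hj; simp
      · simp [hj, hM]
    rw [hnew] at hval
    refine ⟨Function.update ξ k η, fun j => ?_, ?_⟩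
    · by_cases hj : j = k
      · subst hj; simpa using hη
      · simpa [hj] using hξ j
    · rw [Finset.prod_insert hkS, Finset.prod_insert hkS, mul_assoc, h, mul_left_comm, hval]
      simp only [Function.Embedding.coeFn_mk]
      ring

/-- **Mean value theorem for alternant determinants**. -/
theorem exists_prod_factorial_mul_det_eq {N : ℕ} {l u : ℝ} {f : Fin N → ℝ → ℝ}
    (hf : ∀ i, ContDiff ℝ N (f i)) {a : Fin N → ℝ} (ha : StrictMono a)
    (hmem : ∀ i, a i ∈ Set.Icc l u) :
    ∃ ξ : Fin N → ℝ, (∀ j, ξ j ∈ Set.Icc l u) ∧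
      (∏ j : Fin N, ((j : ℕ).factorial : ℝ)) * (Matrix.of fun i j => f i (a j)).det =
        (∏ i : Fin N, ∏ j ∈ Finset.Ioi i, (a j - a i)) *
          (Matrix.of fun i j : Fin N => iteratedDeriv j (f i) (ξ j)).det := by
  obtain ⟨ξ, hξ, h⟩ := exists_prod_factorial_mul_det_eq_of_finset hf ha hmem Finset.univ
  refine ⟨ξ, hξ, ?_⟩
  rw [Finset.prod_comm' (t' := Finset.univ) (s' := fun j => Finset.Iio j) (by simp)]
  simpa using h

theorem det_heatKernel {N : ℕ} (T : ℝ) (a b : Fin N → ℝ) :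
    (Matrix.of fun i j => heatKernel T (b i) (a j)).det =
      Real.exp (-(∑ j, b j ^ 2) / (2 * T)) / Real.sqrt (2 * Real.pi * T) ^ N *
        (Real.exp (-(∑ j, a j ^ 2) / (2 * T)) *
          (Matrix.of fun i j => Real.exp (b i / T * a j)).det) := by
  have hentry : (Matrix.of fun i j => heatKernel T (b i) (a j)) =
      Matrix.of fun i j => (Real.exp (-b i ^ 2 / (2 * T)) / Real.sqrt (2 * Real.pi * T)) *
        (Matrix.of fun i j => Real.exp (-a j ^ 2 / (2 * T)) *
          (Matrix.of fun i j => Real.exp (b i / T * a j)) i j) i j := by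
    ext i j
    simp only [Matrix.of_apply, heatKernel, div_mul_eq_mul_div, ← Real.exp_add]
    congr 2
    ring
  rw [hentry, Matrix.det_mul_column, Matrix.det_mul_row, Finset.prod_div_distrib,
    ← Real.exp_sum, ← Real.exp_sum]
  simp [Finset.sum_div, Finset.sum_neg_distrib, neg_div]

theorem prod_prod_Ioi_div {N : ℕ} (T : ℝ) (b : Fin N → ℝ) :
    ∏ i : Fin N, ∏ j ∈ Finset.Ioi i, (b j / T - b i / T) =
      T⁻¹ ^ (∑ k ∈ Finset.range N, k) * ∏ i : Fin N, ∏ j ∈ Finset.Ioi i, (b j - b i) := by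
  have hentry : Matrix.vandermonde (fun i => b i / T) =
      Matrix.of fun i (j : Fin N) => T⁻¹ ^ (j : ℕ) * Matrix.vandermonde b i j := by
    ext i j
    simp [Matrix.vandermonde_apply, div_eq_mul_inv, mul_pow, mul_comm]
  rw [← Matrix.det_vandermonde, ← Matrix.det_vandermonde, hentry, Matrix.det_mul_row,
    Finset.prod_pow_eq_pow_sum, Fin.sum_univ_eq_sum_range fun k => k]

theorem rpow_neg_sq_div_two_div {T : ℝ} (hT : 0 < T) (N : ℕ) :
    T ^ (-(N ^ 2 : ℝ) / 2) / (2 * Real.pi) ^ ((N : ℝ) / 2) =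
      T⁻¹ ^ (∑ k ∈ Finset.range N, k) / Real.sqrt (2 * Real.pi * T) ^ N := by
  have hpi : 0 < 2 * Real.pi := by positivity
  have hsum : ((∑ k ∈ Finset.range N, k : ℕ) : ℝ) = ((N : ℝ) ^ 2 - N) / 2 := by
    induction N with
    | zero => simp
    | succ n ih => rw [Finset.sum_range_succ, Nat.cast_add, ih]; push_cast; ring
  have hsqrt : Real.sqrt (2 * Real.pi * T) ^ N =
      (2 * Real.pi) ^ ((N : ℝ) / 2) * T ^ ((N : ℝ) / 2) := by
    rw [← Real.mul_rpow hpi.le hT.le, Real.sqrt_eq_rpow, ← Real.rpow_natCast,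
      ← Real.rpow_mul (by positivity)]
    congr 1
    ring
  rw [hsqrt, inv_pow, ← Real.rpow_natCast T, ← Real.rpow_neg hT.le, hsum,
    mul_comm (_ ^ _) (T ^ _), ← div_div, ← Real.rpow_sub hT]
  congr 2
  ring

/-- The Karlin–McGregor determinant is the Vandermonde product of the starting points times a
smooth function evaluated at points no farther from the origin than the starting points. -/
theorem exists_prod_factorial_mul_det_heatKernel_eq {N : ℕ} (T : ℝ) (b : Fin N → ℝ)
    {a : Fin N → ℝ} (ha : StrictMono a) :
    ∃ ξ : Fin N → ℝ, ‖ξ‖ ≤ ‖a‖ ∧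
      (∏ k ∈ Finset.range N, (k.factorial : ℝ)) *
          (Matrix.of fun i j => heatKernel T (b i) (a j)).det =
        Real.exp (-(∑ j, b j ^ 2) / (2 * T)) / Real.sqrt (2 * Real.pi * T) ^ N *
          (∏ i : Fin N, ∏ j ∈ Finset.Ioi i, (a j - a i)) *
          (Real.exp (-(∑ j, a j ^ 2) / (2 * T)) *
            (Matrix.of fun i j : Fin N =>
              (b i / T) ^ (j : ℕ) * Real.exp (b i / T * ξ j)).det) := by
  obtain ⟨ξ, hξ, h⟩ := exists_prod_factorial_mul_det_eq (l := -‖a‖) (u := ‖a‖)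
    (f := fun i t => Real.exp (b i / T * t)) (fun i => by fun_prop) ha
    (fun i => abs_le.1 (norm_le_pi_norm a i))
  refine ⟨ξ, (pi_norm_le_iff_of_nonneg (norm_nonneg a)).2 fun j => abs_le.2 (hξ j), ?_⟩
  rw [Fin.prod_univ_eq_prod_range fun k => (k.factorial : ℝ)] at h
  simp only [iteratedDeriv_exp_const_mul] at h
  rw [det_heatKernel]
  linear_combination Real.exp (-(∑ j, b j ^ 2) / (2 * T)) / Real.sqrt (2 * Real.pi * T) ^ N *
    Real.exp (-(∑ j, a j ^ 2) / (2 * T)) * h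

/-- Leading-order asymptotics of the Karlin–McGregor determinant as the starting
points coincide at the origin: the determinant equals the leading term times
`(1 + O(|a|))` as `a → 0` within the Weyl chamber. -/
theorem karlinMcGregor_asymptotics (N : ℕ) (T : ℝ) (hT : 0 < T)
    (b : Fin N → ℝ) (hb : StrictMono b) :
    (fun a : Fin N → ℝ =>
        Matrix.det (Matrix.of fun i j : Fin N => heatKernel T (b i) (a j)) -
          (T ^ (-(N ^ 2 : ℝ) / 2) /
              ((2 * Real.pi) ^ ((N : ℝ) / 2) * ∏ k ∈ Finset.range N, (k.factorial : ℝ))) *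
            Real.exp (-(∑ j, b j ^ 2) / (2 * T)) *
            ∏ i : Fin N, ∏ j ∈ Finset.Ioi i, ((a j - a i) * (b j - b i)))
      =O[nhdsWithin 0 {a : Fin N → ℝ | StrictMono a}]
    (fun a : Fin N → ℝ =>
        ‖a‖ *
          ((T ^ (-(N ^ 2 : ℝ) / 2) /
              ((2 * Real.pi) ^ ((N : ℝ) / 2) * ∏ k ∈ Finset.range N, (k.factorial : ℝ))) *
            Real.exp (-(∑ j, b j ^ 2) / (2 * T)) *
            ∏ i : Fin N, ∏ j ∈ Finset.Ioi i, ((a j - a i) * (b j - b i)))) := by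
  choose! ξ hξ hdet using fun (a : Fin N → ℝ) (ha : StrictMono a) =>
    exists_prod_factorial_mul_det_heatKernel_eq T b ha
  set H : (Fin N → ℝ) × (Fin N → ℝ) → ℝ := fun p =>
    Real.exp (-(∑ j, p.1 j ^ 2) / (2 * T)) *
      (Matrix.of fun i j : Fin N => (b i / T) ^ (j : ℕ) * Real.exp (b i / T * p.2 j)).det with hH
  set P : ℝ := ∏ k ∈ Finset.range N, (k.factorial : ℝ)
  have hP0 : P ≠ 0 := Finset.prod_ne_zero_iff.2 fun k _ => by positivity
  have hH0 : H 0 = ∏ i : Fin N, ∏ j ∈ Finset.Ioi i, (b j / T - b i / T) := by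
    rw [← Matrix.det_vandermonde]
    simp [hH, Matrix.vandermonde]
  have hH0_ne : H 0 ≠ 0 := by
    rw [hH0, ← Matrix.det_vandermonde, Matrix.det_vandermonde_ne_zero_iff]
    exact fun i j hij => hb.injective ((div_left_inj' hT.ne').1 hij)
  have hHdiff : DifferentiableAt ℝ H 0 := by
    simp only [hH, Matrix.det_apply, Matrix.of_apply]
    fun_prop
  set W : Set (Fin N → ℝ) := {a | StrictMono a}
  have hmem : ∀ᶠ a in nhdsWithin 0 W, StrictMono a := eventually_mem_nhdsWithin
  have hpair : (fun a => (a, ξ a)) =O[nhdsWithin 0 W] fun a => ‖a‖ := by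
    refine IsBigO.of_bound 1 (hmem.mono fun a ha => ?_)
    simpa [Prod.norm_def] using hξ a ha
  have hpair_tendsto : Tendsto (fun a => (a, ξ a)) (nhdsWithin 0 W) (nhds 0) :=
    hpair.trans_tendsto (tendsto_norm_zero.mono_left nhdsWithin_le_nhds)
  have hHO : (fun a => H (a, ξ a) - H 0) =O[nhdsWithin 0 W] fun a => ‖a‖ := by
    have h := hHdiff.isBigO_sub.comp_tendsto hpair_tendsto
    simp only [Function.comp_def, sub_zero] at h
    exact h.trans hpair
  set K : (Fin N → ℝ) → ℝ := fun a =>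
    Real.exp (-(∑ j, b j ^ 2) / (2 * T)) / Real.sqrt (2 * Real.pi * T) ^ N / P *
      ∏ i : Fin N, ∏ j ∈ Finset.Ioi i, (a j - a i) with hK
  have hlead (a : Fin N → ℝ) :
      (T ^ (-(N ^ 2 : ℝ) / 2) / ((2 * Real.pi) ^ ((N : ℝ) / 2) * P)) *
        Real.exp (-(∑ j, b j ^ 2) / (2 * T)) *
        ∏ i : Fin N, ∏ j ∈ Finset.Ioi i, ((a j - a i) * (b j - b i)) = K a * H 0 := by
    simp only [Finset.prod_mul_distrib]
    rw [← div_div, rpow_neg_sq_div_two_div hT, hH0, prod_prod_Ioi_div, hK]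
    ring
  simp only [hlead]
  have hmain : (fun a => K a * (H (a, ξ a) - H 0)) =O[nhdsWithin 0 W]
      fun a => ‖a‖ * (K a * H 0) := by
    have h := (isBigO_refl K (nhdsWithin 0 W)).mul
      (hHO.trans (isBigO_self_const_mul hH0_ne (fun a => ‖a‖) _))
    exact h.congr_right fun a => by ring
  refine hmain.congr' (hmem.mono fun a ha => ?_) EventuallyEq.rfl
  have h := hdet a ha
  have hdet_eq : (Matrix.of fun i j => heatKernel T (b i) (a j)).det = K a * H (a, ξ a) := by
    refine mul_left_cancel₀ hP0 (h.trans ?_)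
    simp only [hK, hH]
    field_simp
  beta_reduce
  rw [hdet_eq, mul_sub]
end
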